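/- arXiv:1405.0673 — 4 statements merged into one kernel-verified Lean document; each statement's English description precedes it below -/
import Mathlib

section
/- Let σ₁ > 0 and σ₂ > 0, let β₁, β₂ ∈ ℝ, and let X ⊆ ℝ be a set containing at least two distinct elements. If exp(x·β₁ + σ₁·z)/σ₁ = exp(x·β₂ + σ₂·z)/σ₂ for all x ∈ X and all z ∈ ℝ, then β₁ = β₂ and σ₁ = σ₂. Consequently, for a Poisson generalized linear mixed model with logarithmic link whose explanatory variable takes at least two distinct values, the identifiability equation for the mean has no solution with (β₁, σ₁) ≠ (β₂, σ₂). -/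
theorem poisson_log_link_identifiable
    (σ₁ σ₂ : ℝ) (hσ₁ : 0 < σ₁) (hσ₂ : 0 < σ₂)
    (β₁ β₂ : ℝ) (X : Set ℝ)
    (hX : ∃ x₁ ∈ X, ∃ x₂ ∈ X, x₁ ≠ x₂)
    (heq : ∀ x ∈ X, ∀ z : ℝ,
      Real.exp (x * β₁ + σ₁ * z) / σ₁ = Real.exp (x * β₂ + σ₂ * z) / σ₂) :
    β₁ = β₂ ∧ σ₁ = σ₂ := by
  obtain ⟨a, ha, b, hb, hab⟩ := hX
  have key : ∀ x ∈ X, ∀ z : ℝ,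
      x * β₁ + σ₁ * z - Real.log σ₁ = x * β₂ + σ₂ * z - Real.log σ₂ := by
    intro x hx z
    have h := congrArg Real.log (heq x hx z)
    rwa [Real.log_div (Real.exp_ne_zero _) hσ₁.ne', Real.log_div (Real.exp_ne_zero _) hσ₂.ne',
      Real.log_exp, Real.log_exp] at h
  have h0 := key a ha 0
  have h1 := key a ha 1
  have h2 := key b hb 0
  refine ⟨?_, by linarith⟩
  have h3 : (a - b) * (β₁ - β₂) = 0 := by linarith
  rcases mul_eq_zero.mp h3 with h | h
  · exact absurd (sub_eq_zero.mp h) hab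
  · exact sub_eq_zero.mp h
end

section
/- Let φ : ℝ → ℝ be a continuous function with φ(z) > 0 for all z ∈ ℝ, let σ₁ > 0 and σ₂ > 0, let β₁, β₂ ∈ ℝ, and let X ⊆ ℝ be a set containing at least two distinct elements. Assume that for each x ∈ X and each i ∈ {1,2} the function z ↦ exp(x·βᵢ + σᵢ·z)·φ(z) is integrable on ℝ. If for every x ∈ X and every pair of real numbers a ≤ b one has (1/σ₁)·∫_{a}^{b} exp(x·β₁ + σ₁·z)·φ(z) dz = (1/σ₂)·∫_{a}^{b} exp(x·β₂ + σ₂·z)·φ(z) dz, then β₁ = β₂ and σ₁ = σ₂. -/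
open MeasureTheory intervalIntegral

theorem poisson_glmm_mean_identifiable
    (φ : ℝ → ℝ) (hφc : Continuous φ) (hφpos : ∀ z : ℝ, 0 < φ z)
    (σ₁ σ₂ : ℝ) (hσ₁ : 0 < σ₁) (hσ₂ : 0 < σ₂)
    (β₁ β₂ : ℝ) (X : Set ℝ)
    (hX : ∃ x₁ ∈ X, ∃ x₂ ∈ X, x₁ ≠ x₂)
    (hint₁ : ∀ x ∈ X, Integrable (fun z : ℝ => Real.exp (x * β₁ + σ₁ * z) * φ z))
    (hint₂ : ∀ x ∈ X, Integrable (fun z : ℝ => Real.exp (x * β₂ + σ₂ * z) * φ z))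
    (heq : ∀ x ∈ X, ∀ a b : ℝ, a ≤ b →
      (1 / σ₁) * ∫ z in a..b, Real.exp (x * β₁ + σ₁ * z) * φ z
        = (1 / σ₂) * ∫ z in a..b, Real.exp (x * β₂ + σ₂ * z) * φ z) :
    β₁ = β₂ ∧ σ₁ = σ₂ := by
  have key : ∀ x ∈ X, ∀ z : ℝ,
      x * β₁ + σ₁ * z - Real.log σ₁ = x * β₂ + σ₂ * z - Real.log σ₂ := by
    intro x hx z
    have c1 : Continuous (fun z : ℝ => Real.exp (x * β₁ + σ₁ * z) * φ z) := by fun_prop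
    have c2 : Continuous (fun z : ℝ => Real.exp (x * β₂ + σ₂ * z) * φ z) := by fun_prop
    have d1 := (c1.integral_hasStrictDerivAt 0 z).hasDerivAt.const_mul (1 / σ₁)
    have d2 := (c2.integral_hasStrictDerivAt 0 z).hasDerivAt.const_mul (1 / σ₂)
    have e : (fun b : ℝ => (1 / σ₁) * ∫ z in (0:ℝ)..b, Real.exp (x * β₁ + σ₁ * z) * φ z)
        = fun b : ℝ => (1 / σ₂) * ∫ z in (0:ℝ)..b, Real.exp (x * β₂ + σ₂ * z) * φ z := by
      funext b
      rcases le_total 0 b with h | h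
      · exact heq x hx 0 b h
      · have := heq x hx b 0 h
        rw [intervalIntegral.integral_symm b 0, intervalIntegral.integral_symm b 0]
        linarith
    rw [e] at d1
    have h := d1.unique d2
    rw [← mul_assoc, ← mul_assoc] at h
    have h2 := congrArg Real.log (mul_right_cancel₀ (hφpos z).ne' h)
    rw [Real.log_mul (by positivity) (by positivity),
      Real.log_mul (by positivity) (by positivity), Real.log_exp, Real.log_exp,
      one_div, one_div, Real.log_inv, Real.log_inv] at h2
    linarith
  obtain ⟨x₁, h₁, x₂, h₂, hne⟩ := hX
  have a0 := key x₁ h₁ 0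
  have a1 := key x₁ h₁ 1
  have b0 := key x₂ h₂ 0
  have hσ : σ₁ = σ₂ := by linarith
  refine ⟨?_, hσ⟩
  subst hσ
  have : (x₁ - x₂) * (β₁ - β₂) = 0 := by linarith
  rcases mul_eq_zero.1 this with h | h
  · exact absurd (sub_eq_zero.1 h) hne
  · exact sub_eq_zero.1 h
end

section
/- Let h : ℝ → ℝ be the logistic function h(t) = exp(t)/(1 + exp(t)), let σ₁ > 0 and σ₂ > 0, let β₁, β₂ ∈ ℝ, and let X ⊆ ℝ be a set containing at least one nonzero element. If h(x·β₁ + σ₁·z)/σ₁ = h(x·β₂ + σ₂·z)/σ₂ for all x ∈ X and all z ∈ ℝ, then β₁ = β₂ and σ₁ = σ₂. Consequently, for a binomial generalized linear mixed model with logistic link whose explanatory variable takes a nonzero value, the identifiability equation for the mean has no solution with (β₁, σ₁) ≠ (β₂, σ₂). -/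
theorem binomial_logistic_link_identifiable
    (h : ℝ → ℝ) (hdef : ∀ t : ℝ, h t = Real.exp t / (1 + Real.exp t))
    (σ₁ σ₂ : ℝ) (hσ₁ : 0 < σ₁) (hσ₂ : 0 < σ₂)
    (β₁ β₂ : ℝ) (X : Set ℝ)
    (hX : ∃ x ∈ X, x ≠ 0)
    (heq : ∀ x ∈ X, ∀ z : ℝ,
      h (x * β₁ + σ₁ * z) / σ₁ = h (x * β₂ + σ₂ * z) / σ₂) :
    β₁ = β₂ ∧ σ₁ = σ₂ := by
  obtain ⟨x, hx, hx0⟩ := hX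
  have hh : h = fun t => (1 + Real.exp (-t))⁻¹ := by
    funext t
    rw [hdef, Real.exp_neg]
    have := Real.exp_pos t
    field_simp
    ring
  have hlim : Filter.Tendsto h Filter.atTop (nhds 1) := by
    have h1 : Filter.Tendsto (fun t : ℝ => (1 + Real.exp (-t))⁻¹) Filter.atTop
        (nhds ((1 + 0 : ℝ)⁻¹)) :=
      (tendsto_const_nhds.add Real.tendsto_exp_neg_atTop_nhds_zero).inv₀ (by norm_num)
    rw [hh]
    simpa using h1
  have key : ∀ b s : ℝ, 0 < s → Filter.Tendsto (fun z => h (x * b + s * z) / s)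
      Filter.atTop (nhds (1 / s)) := fun b s hs =>
    (hlim.comp (Filter.tendsto_atTop_add_const_left _ _
      (Filter.tendsto_id.const_mul_atTop hs))).div_const s
  have hs : σ₁ = σ₂ := by
    have k1 := key β₁ σ₁ hσ₁
    rw [funext (heq x hx)] at k1
    have := tendsto_nhds_unique k1 (key β₂ σ₂ hσ₂)
    simpa using this
  refine ⟨?_, hs⟩
  subst hs
  have e := heq x hx 0
  rw [div_left_inj' hσ₁.ne', hh] at e
  simpa [hx0] using e
end

section
/- Let Φ : ℝ → ℝ be the standard Gaussian cumulative distribution function, Φ(t) = ∫_{-∞}^{t} exp(−s²/2)/√(2π) ds, let σ₁ > 0 and σ₂ > 0, let β₁, β₂ ∈ ℝ, and let X ⊆ ℝ be a set containing at least one nonzero element. If Φ(x·β₁ + σ₁·z)/σ₁ = Φ(x·β₂ + σ₂·z)/σ₂ for all x ∈ X and all z ∈ ℝ, then β₁ = β₂ and σ₁ = σ₂. Consequently, for a binomial generalized linear mixed model with probit link whose explanatory variable takes a nonzero value, the identifiability equation for the mean has no solution with (β₁, σ₁) ≠ (β₂, σ₂). -/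
open MeasureTheory

theorem binomial_probit_link_identifiable
    (Φ : ℝ → ℝ)
    (hΦ : ∀ t : ℝ, Φ t = ∫ s in Set.Iic t, Real.exp (-s ^ 2 / 2) / Real.sqrt (2 * Real.pi))
    (σ₁ σ₂ : ℝ) (hσ₁ : 0 < σ₁) (hσ₂ : 0 < σ₂)
    (β₁ β₂ : ℝ) (X : Set ℝ)
    (hX : ∃ x ∈ X, x ≠ 0)
    (heq : ∀ x ∈ X, ∀ z : ℝ,
      Φ (x * β₁ + σ₁ * z) / σ₁ = Φ (x * β₂ + σ₂ * z) / σ₂) :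
    β₁ = β₂ ∧ σ₁ = σ₂ := by
  obtain ⟨x, hx, hx0⟩ := hX
  have hint : Integrable (fun s : ℝ => Real.exp (-s ^ 2 / 2) / Real.sqrt (2 * Real.pi)) := by
    have h := (integrable_exp_neg_mul_sq (b := 1 / 2) (by norm_num)).div_const
      (Real.sqrt (2 * Real.pi))
    refine h.congr (Filter.Eventually.of_forall fun s => ?_)
    simp only
    congr 2
    ring
  have hpos : ∀ s : ℝ, 0 < Real.exp (-s ^ 2 / 2) / Real.sqrt (2 * Real.pi) := fun s => by
    positivity
  have hmono : StrictMono Φ := by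
    intro a b hab
    have h1 := intervalIntegral.integral_Iic_sub_Iic (μ := volume) (a := a) (b := b)
      hint.integrableOn hint.integrableOn
    have h2 := intervalIntegral.intervalIntegral_pos_of_pos (a := a) (b := b)
      hint.intervalIntegrable hpos hab
    rw [← h1, ← hΦ, ← hΦ] at h2
    linarith
  have hlim : Filter.Tendsto Φ Filter.atTop
      (nhds (∫ s : ℝ, Real.exp (-s ^ 2 / 2) / Real.sqrt (2 * Real.pi))) := by
    rw [funext hΦ]
    exact (aecover_Iic Filter.tendsto_id).integral_tendsto_of_countably_generated hint
  set I := ∫ s : ℝ, Real.exp (-s ^ 2 / 2) / Real.sqrt (2 * Real.pi)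
  have hI : 0 < I := by
    have h0 : 0 ≤ Φ 0 := by
      rw [hΦ]
      exact integral_nonneg fun s => (hpos s).le
    exact (h0.trans_lt (hmono one_pos)).trans_le (hmono.monotone.ge_of_tendsto hlim 1)
  have key : ∀ β σ : ℝ, 0 < σ → Filter.Tendsto (fun z => Φ (x * β + σ * z) / σ) Filter.atTop
      (nhds (I / σ)) := fun β σ hσ =>
    (hlim.comp (Filter.tendsto_atTop_add_const_left _ _
      (Filter.tendsto_id.const_mul_atTop hσ))).div_const σ
  have hs : I / σ₁ = I / σ₂ := by
    refine tendsto_nhds_unique (key β₁ σ₁ hσ₁) ?_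
    rw [funext (heq x hx)]
    exact key β₂ σ₂ hσ₂
  have hσ : σ₁ = σ₂ := by
    rw [div_eq_div_iff hσ₁.ne' hσ₂.ne'] at hs
    exact (mul_left_cancel₀ hI.ne' hs).symm
  subst hσ
  refine ⟨?_, rfl⟩
  have h := heq x hx 0
  rw [div_left_inj' hσ₁.ne'] at h
  have h' := hmono.injective h
  exact mul_left_cancel₀ hx0 (add_right_cancel h')
end
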